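/- If ⟨ψ_k, (B ⊗ I_n) ψ_l⟩ = 0 for all k, l with 1 ≤ k, l ≤ 4p−4 and k ≠ l, then the top-left p×p block of B is a scalar multiple of the identity: B_{ab} = B_{00}·δ_{ab} for all 0 ≤ a, b ≤ p−1. -/

import Mathlib

open scoped ComplexInnerProductSpace Kronecker ComplexOrder

/-- The `i`-th standard basis vector `|i⟩` of `ℂ^m` (zero if `i ≥ m`). -/
noncomputable def ket (m i : ℕ) : EuclideanSpace ℂ (Fin m) :=
  (WithLp.equiv 2 (Fin m → ℂ)).symm fun a => if (a : ℕ) = i then 1 else 0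

/-- The product state `v ⊗ w`, with entries `(v ⊗ w)_{(a,b)} = v_a * w_b`. -/
noncomputable def tp {m n : ℕ} (v : EuclideanSpace ℂ (Fin m)) (w : EuclideanSpace ℂ (Fin n)) :
    EuclideanSpace ℂ (Fin m × Fin n) :=
  (WithLp.equiv 2 (Fin m × Fin n → ℂ)).symm fun ab => v ab.1 * w ab.2

/-- The scalar `1/√2`. -/
noncomputable def invSqrt2 : ℂ := ((Real.sqrt 2)⁻¹ : ℝ)

/-- A matrix on `ℂ^m ⊗ ℂ^n` acting as a linear map. -/
noncomputable def act {m n : ℕ} (M : Matrix (Fin m × Fin n) (Fin m × Fin n) ℂ)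
    (x : EuclideanSpace ℂ (Fin m × Fin n)) : EuclideanSpace ℂ (Fin m × Fin n) :=
  Matrix.toEuclideanLin M x

/-- The index `j(i)`: `j(i) = i + 1` for `i ≤ p - 2`, and `j(p-1) = 1`. -/
def jf (p i : ℕ) : ℕ := if i = p - 1 then 1 else i + 1

/-- The `4p-4` product states `ψ_k` (`1 ≤ k ≤ 4p-4`):
`ψ_i = |i⟩ ⊗ (|0⟩-|i⟩)/√2`, `ψ_{i+p-1} = (|0⟩-|i⟩)/√2 ⊗ |j(i)⟩`,
`ψ_{i+2p-2} = |i⟩ ⊗ (|0⟩+|i⟩)/√2`, `ψ_{i+3p-3} = (|0⟩+|i⟩)/√2 ⊗ |j(i)⟩`, for `1 ≤ i ≤ p-1`. -/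
noncomputable def psi (m n p k : ℕ) : EuclideanSpace ℂ (Fin m × Fin n) :=
  if k ≤ p - 1 then tp (ket m k) (invSqrt2 • (ket n 0 - ket n k))
  else if k ≤ 2 * p - 2 then
    tp (invSqrt2 • (ket m 0 - ket m (k - (p - 1)))) (ket n (jf p (k - (p - 1))))
  else if k ≤ 3 * p - 3 then
    tp (ket m (k - (2 * p - 2))) (invSqrt2 • (ket n 0 + ket n (k - (2 * p - 2))))
  else tp (invSqrt2 • (ket m 0 + ket m (k - (3 * p - 3)))) (ket n (jf p (k - (3 * p - 3))))

theorem inner_tp_act_kronecker_one {m n : ℕ} (B : Matrix (Fin m) (Fin m) ℂ)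
    (v v' : EuclideanSpace ℂ (Fin m)) (w w' : EuclideanSpace ℂ (Fin n)) :
    ⟪tp v w, act (B ⊗ₖ (1 : Matrix (Fin n) (Fin n) ℂ)) (tp v' w')⟫ =
      ⟪v, Matrix.toEuclideanLin B v'⟫ * ⟪w, w'⟫ := by
  have act_tp : act (B ⊗ₖ (1 : Matrix (Fin n) (Fin n) ℂ)) (tp v' w') =
      tp (Matrix.toEuclideanLin B v') w' := by
    ext ⟨a, b⟩
    simp only [act, tp, Matrix.toLpLin_apply, Matrix.mulVec, dotProduct,
      Matrix.kroneckerMap_apply, Fintype.sum_prod_type, WithLp.equiv_symm_apply,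
      Matrix.one_apply, Finset.sum_mul]
    refine Finset.sum_congr rfl fun c _ => ?_
    simp [mul_assoc]
  rw [act_tp]
  simp only [tp, PiLp.inner_apply, RCLike.inner_apply, Fintype.sum_prod_type,
    WithLp.equiv_symm_apply, map_mul, Finset.sum_mul_sum]
  refine Finset.sum_congr rfl fun a _ => Finset.sum_congr rfl fun b _ => ?_
  ring

theorem ket_val {m : ℕ} (a : Fin m) : ket m a = EuclideanSpace.single a 1 := by
  ext c
  simp [ket, Fin.ext_iff]

theorem inner_ket_ket {n i j : ℕ} (hi : i < n) (hj : j < n) :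
    ⟪ket n i, ket n j⟫ = if i = j then 1 else 0 := by
  have hi' := ket_val (⟨i, hi⟩ : Fin n)
  have hj' := ket_val (⟨j, hj⟩ : Fin n)
  rw [hi', hj']
  simp [EuclideanSpace.inner_single_left, Fin.ext_iff]

theorem inner_ket_toEuclideanLin_ket {m : ℕ} (B : Matrix (Fin m) (Fin m) ℂ) {i j : ℕ}
    (hi : i < m) (hj : j < m) :
    ⟪ket m i, Matrix.toEuclideanLin B (ket m j)⟫ = B ⟨i, hi⟩ ⟨j, hj⟩ := by
  have hi' := ket_val (⟨i, hi⟩ : Fin m)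
  have hj' := ket_val (⟨j, hj⟩ : Fin m)
  rw [hi', hj']
  simp [EuclideanSpace.inner_single_left, Matrix.toLpLin_apply]

theorem invSqrt2_ne_zero : invSqrt2 ≠ 0 := by
  simp [invSqrt2]

theorem psi_ket_sub (m n : ℕ) {p i : ℕ} (hi : i ≤ p - 1) :
    psi m n p i = tp (ket m i) (invSqrt2 • (ket n 0 - ket n i)) := by
  simp [psi, hi]

theorem psi_sub_ket (m n : ℕ) {p i : ℕ} (hi0 : 1 ≤ i) (hi : i ≤ p - 1) :
    psi m n p (i + (p - 1)) =
      tp (invSqrt2 • (ket m 0 - ket m i)) (ket n (jf p i)) := by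
  rw [psi, if_neg (by omega), if_pos (by omega), Nat.add_sub_cancel]

theorem psi_add_ket (m n : ℕ) {p i : ℕ} (hi0 : 1 ≤ i) (hi : i ≤ p - 1) :
    psi m n p (i + (3 * p - 3)) =
      tp (invSqrt2 • (ket m 0 + ket m i)) (ket n (jf p i)) := by
  rw [psi, if_neg (by omega), if_neg (by omega), if_neg (by omega), Nat.add_sub_cancel]

theorem exists_jf_eq {p a : ℕ} (hp : 3 ≤ p) (ha0 : 1 ≤ a) (ha : a ≤ p - 1) :
    ∃ i, 1 ≤ i ∧ i ≤ p - 1 ∧ i ≠ a ∧ jf p i = a := by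
  unfold jf
  by_cases h : a = 1
  · exact ⟨p - 1, by omega, by omega, by omega, by simp [h]⟩
  · exact ⟨a - 1, by omega, by omega, by omega, by rw [if_neg (by omega)]; omega⟩

theorem top_left_block_scalar (p m n : ℕ) (h3 : 3 ≤ p) (hpm : p ≤ m) (hmn : m ≤ n)
    (B : Matrix (Fin m) (Fin m) ℂ) (hB : B.PosSemidef)
    (h : ∀ k l : ℕ, 1 ≤ k → k ≤ 4 * p - 4 → 1 ≤ l → l ≤ 4 * p - 4 → k ≠ l →
      ⟪psi m n p k, act (B ⊗ₖ (1 : Matrix (Fin n) (Fin n) ℂ)) (psi m n p l)⟫ = 0) :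
    ∀ a b : Fin m, (a : ℕ) ≤ p - 1 → (b : ℕ) ≤ p - 1 →
      B a b = if (a : ℕ) = (b : ℕ)
        then B (⟨0, by omega⟩ : Fin m) (⟨0, by omega⟩ : Fin m) else 0 := by
  have h0m : 0 < m := by omega
  have h0n : 0 < n := by omega
  have off_diag : ∀ i j (hi : i < m) (hj : j < m), 1 ≤ i → i ≤ p - 1 → 1 ≤ j → j ≤ p - 1 →
      i ≠ j → B ⟨i, hi⟩ ⟨j, hj⟩ = 0 := by
    intro i j hi hj hi0 hip hj0 hjp hij
    have hi_ne : i ≠ 0 := by omega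
    have hj_ne : j ≠ 0 := by omega
    have key := h i j hi0 (by omega) hj0 (by omega) hij
    rw [psi_ket_sub m n hip, psi_ket_sub m n hjp, inner_tp_act_kronecker_one,
      inner_ket_toEuclideanLin_ket B hi hj] at key
    simpa [-inner_self_eq_norm_sq_to_K, inner_sub_left, inner_sub_right, inner_smul_left, inner_smul_right,
      inner_ket_ket h0n h0n, inner_ket_ket h0n (hj.trans_le hmn),
      inner_ket_ket (hi.trans_le hmn) h0n, inner_ket_ket (hi.trans_le hmn) (hj.trans_le hmn),
      hij, invSqrt2_ne_zero, hi_ne, hj_ne.symm] using key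
  have zero_row : ∀ j (hj : j < m), 1 ≤ j → j ≤ p - 1 →
      B ⟨0, h0m⟩ ⟨j, hj⟩ = 0 ∧ B ⟨j, hj⟩ ⟨0, h0m⟩ = 0 := by
    intro j hj hj0 hjp
    obtain ⟨i, hi0, hip, hij, hji⟩ := exists_jf_eq h3 hj0 hjp
    have hi : i < m := by omega
    have hj_ne : j ≠ 0 := by omega
    have hjn := hj.trans_le hmn
    constructor
    · have key := h (i + (p - 1)) j (by omega) (by omega) hj0 (by omega) (by omega)
      rw [psi_sub_ket m n hi0 hip, psi_ket_sub m n hjp, inner_tp_act_kronecker_one, hji] at key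
      simpa [-inner_self_eq_norm_sq_to_K, inner_sub_left, inner_sub_right, inner_smul_left, inner_smul_right,
        inner_ket_ket hjn h0n, inner_ket_ket hjn hjn, inner_ket_toEuclideanLin_ket B h0m hj,
        inner_ket_toEuclideanLin_ket B hi hj, off_diag i j hi hj hi0 hip hj0 hjp hij,
        invSqrt2_ne_zero, hj_ne] using key
    · have key := h j (i + (p - 1)) hj0 (by omega) (by omega) (by omega) (by omega)
      rw [psi_sub_ket m n hi0 hip, psi_ket_sub m n hjp, inner_tp_act_kronecker_one, hji] at key
      simpa [-inner_self_eq_norm_sq_to_K, inner_sub_left, inner_sub_right, inner_smul_left, inner_smul_right,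
        inner_ket_ket h0n hjn, inner_ket_ket hjn hjn, inner_ket_toEuclideanLin_ket B hj h0m,
        inner_ket_toEuclideanLin_ket B hj hi, off_diag j i hj hi hj0 hjp hi0 hip hij.symm,
        invSqrt2_ne_zero, hj_ne.symm] using key
  have diag : ∀ i (hi : i < m), 1 ≤ i → i ≤ p - 1 → B ⟨i, hi⟩ ⟨i, hi⟩ = B ⟨0, h0m⟩ ⟨0, h0m⟩ := by
    intro i hi hi0 hip
    have hjn : jf p i < n := by unfold jf; split_ifs <;> omega
    have key := h (i + (p - 1)) (i + (3 * p - 3)) (by omega) (by omega) (by omega) (by omega)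
      (by omega)
    rw [psi_sub_ket m n hi0 hip, psi_add_ket m n hi0 hip, inner_tp_act_kronecker_one,
      inner_ket_ket hjn hjn] at key
    obtain ⟨h0i, hi0'⟩ := zero_row i hi hi0 hip
    simp [inner_ket_toEuclideanLin_ket B h0m h0m, inner_ket_toEuclideanLin_ket B h0m hi,
      inner_ket_toEuclideanLin_ket B hi h0m, inner_ket_toEuclideanLin_ket B hi hi,
      h0i, hi0'] at key
    have scaled : invSqrt2 * (starRingEnd ℂ) invSqrt2 *
        (B ⟨0, h0m⟩ ⟨0, h0m⟩ - B ⟨i, hi⟩ ⟨i, hi⟩) = 0 := by linear_combination key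
    symm
    simpa [invSqrt2_ne_zero, sub_eq_zero] using scaled
  rintro ⟨a, ha⟩ ⟨b, hb⟩ hap hbp
  simp only at hap hbp ⊢
  split_ifs with hab
  · subst hab
    rcases Nat.eq_zero_or_pos a with rfl | ha0
    · rfl
    · exact diag a ha ha0 hap
  · rcases Nat.eq_zero_or_pos a with rfl | ha0
    · exact (zero_row b hb (by omega) hbp).1
    · rcases Nat.eq_zero_or_pos b with rfl | hb0
      · exact (zero_row a ha ha0 hap).2
      · exact off_diag a b ha hb ha0 hap hb0 hbp hab
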